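/- arXiv:2404.00479 — 2 statements merged into one kernel-verified Lean document; each statement's English description precedes it below -/
import Mathlib

section
/- Let p ≥ 2 be a real number. For all real numbers a, b ≥ 0 it holds that a^(p−1) − |a−b|^(p−2)(a−b) ≤ (p−1)·max{a^(p−2), b^(p−2)}·b. -/
/-- Scaled Bernoulli inequality: the tangent line of `x ↦ x ^ q` at `a` lies below the graph. -/
theorem rpow_sub_mul_le_rpow_sub {q a b : ℝ} (hq : 1 ≤ q) (ha : 0 < a) (hba : b ≤ a) :
    a ^ q - q * a ^ (q - 1) * b ≤ (a - b) ^ q := by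
  have hs : -1 ≤ -(b / a) := neg_le_neg ((div_le_one ha).2 hba)
  have hbern := one_add_mul_self_le_rpow_one_add hs hq
  have hab : a - b = a * (1 + -(b / a)) := by field_simp; ring
  rw [hab, Real.mul_rpow ha.le (by linarith), Real.rpow_sub_one ha.ne']
  calc a ^ q - q * (a ^ q / a) * b = a ^ q * (1 + q * -(b / a)) := by ring
    _ ≤ _ := mul_le_mul_of_nonneg_left hbern (by positivity)

/-- For a real `p ≥ 2` and nonnegative reals `a, b`,
`a^(p−1) − |a−b|^(p−2)(a−b) ≤ (p−1)·max{a^(p−2), b^(p−2)}·b`. -/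
theorem stmt_0 (p a b : ℝ) (hp : 2 ≤ p) (ha : 0 ≤ a) (hb : 0 ≤ b) :
    a ^ (p - 1) - |a - b| ^ (p - 2) * (a - b) ≤
      (p - 1) * max (a ^ (p - 2)) (b ^ (p - 2)) * b := by
  have hpow : ∀ x : ℝ, 0 ≤ x → x ^ (p - 1) = x ^ (p - 2) * x := fun x hx => by
    rw [← Real.rpow_add_one' hx (by linarith)]
    congr 1
    ring
  have hp2 : 0 ≤ p - 2 := by linarith
  rcases le_or_gt b a with hba | hab
  · rw [abs_of_nonneg (sub_nonneg.2 hba), ← hpow _ (sub_nonneg.2 hba),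
      max_eq_left (Real.rpow_le_rpow hb hba hp2)]
    rcases ha.eq_or_lt with rfl | ha
    · obtain rfl : b = 0 := le_antisymm hba hb
      simp
    · have h := rpow_sub_mul_le_rpow_sub (q := p - 1) (by linarith) ha hba
      rw [show p - 1 - 1 = p - 2 by ring] at h
      linarith
  · have hle := Real.rpow_le_rpow ha hab.le hp2
    rw [abs_of_neg (sub_neg.2 hab), neg_sub, max_eq_right hle, hpow a ha]
    have h₁ := mul_le_mul_of_nonneg_right hle ha
    have h₂ := mul_le_mul_of_nonneg_right
      (Real.rpow_le_rpow (sub_nonneg.2 hab.le) (sub_le_self b ha) hp2) (sub_nonneg.2 hab.le)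
    have h₃ : 0 ≤ (p - 2) * (b ^ (p - 2) * b) := by positivity
    linarith
end

section
/- Let p ≥ 2 and define L_p(τ) = |τ|^(p−2)τ and M_p(τ) = |τ|^(p−2) for τ ∈ ℝ. Then for all a, b ∈ ℝ: (1) |L_p(a) − L_p(b)| ≤ 2^(p−2)(p−1)|a−b|(|a|+|b|)^(p−2); (2) if p ≥ 3, |M_p(a) − M_p(b)| ≤ (p−1)|a−b|(|a|^(p−3)+|b|^(p−3)); (3) if 2 ≤ p < 3, |M_p(a) − M_p(b)| ≤ |a−b|^(p−2). -/
/-- `L_p(τ) = |τ|^(p−2) τ`. -/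
noncomputable def Lfun (p τ : ℝ) : ℝ := |τ| ^ (p - 2) * τ

/-- `M_p(τ) = |τ|^(p−2)`. -/
noncomputable def Mfun (p τ : ℝ) : ℝ := |τ| ^ (p - 2)

/-- Mean value estimate for `x ↦ x ^ q`, `q ≥ 1`, with the larger endpoint on the right. -/
lemma rpow_sub_rpow_le_mul_sub {q x y : ℝ} (hq : 1 ≤ q) (hy : 0 ≤ y) (hyx : y ≤ x) :
    x ^ q - y ^ q ≤ q * (x - y) * x ^ (q - 1) := by
  rcases (hy.trans hyx).eq_or_lt with rfl | hx
  · obtain rfl : y = 0 := le_antisymm hyx hy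
    simp
  · have h := one_add_mul_self_le_rpow_one_add (s := y / x - 1)
      (by linarith [div_nonneg hy hx.le]) hq
    rw [add_sub_cancel, Real.div_rpow hy hx.le, le_div_iff₀ (Real.rpow_pos_of_pos hx q)] at h
    have hxq : x ^ q = x ^ (q - 1) * x := by
      rw [← Real.rpow_add_one hx.ne', sub_add_cancel]
    have e : (1 + q * (y / x - 1)) * x ^ q = x ^ q - q * (x - y) * x ^ (q - 1) := by
      rw [hxq]
      field_simp
      ring
    linarith

lemma abs_rpow_sub_rpow_le_mul_add_rpow {q x y : ℝ} (hq : 1 ≤ q) (hx : 0 ≤ x) (hy : 0 ≤ y) :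
    |x ^ q - y ^ q| ≤ q * |x - y| * (x + y) ^ (q - 1) := by
  wlog h : y ≤ x generalizing x y
  · rw [abs_sub_comm, abs_sub_comm x, add_comm]
    exact this hy hx (le_of_not_ge h)
  rw [abs_of_nonneg (sub_nonneg.2 (Real.rpow_le_rpow hy h (by linarith))),
    abs_of_nonneg (sub_nonneg.2 h)]
  refine (rpow_sub_rpow_le_mul_sub hq hy h).trans ?_
  exact mul_le_mul_of_nonneg_left (Real.rpow_le_rpow hx (by linarith) (by linarith))
    (mul_nonneg (by linarith) (sub_nonneg.2 h))

lemma abs_rpow_sub_rpow_le_mul_rpow_add_rpow {q x y : ℝ} (hq : 1 ≤ q) (hx : 0 ≤ x)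
    (hy : 0 ≤ y) :
    |x ^ q - y ^ q| ≤ q * |x - y| * (x ^ (q - 1) + y ^ (q - 1)) := by
  wlog h : y ≤ x generalizing x y
  · rw [abs_sub_comm, abs_sub_comm x, add_comm]
    exact this hy hx (le_of_not_ge h)
  rw [abs_of_nonneg (sub_nonneg.2 (Real.rpow_le_rpow hy h (by linarith))),
    abs_of_nonneg (sub_nonneg.2 h)]
  refine (rpow_sub_rpow_le_mul_sub hq hy h).trans ?_
  exact mul_le_mul_of_nonneg_left (by linarith [Real.rpow_nonneg hy (q - 1)])
    (mul_nonneg (by linarith) (sub_nonneg.2 h))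

lemma abs_rpow_sub_rpow_le_abs_sub_rpow {q x y : ℝ} (hq : 0 ≤ q) (hq1 : q ≤ 1) (hx : 0 ≤ x)
    (hy : 0 ≤ y) : |x ^ q - y ^ q| ≤ |x - y| ^ q := by
  wlog h : y ≤ x generalizing x y
  · rw [abs_sub_comm, abs_sub_comm x]
    exact this hy hx (le_of_not_ge h)
  rw [abs_of_nonneg (sub_nonneg.2 (Real.rpow_le_rpow hy h hq)), abs_of_nonneg (sub_nonneg.2 h)]
  have := Real.rpow_add_le_add_rpow (sub_nonneg.2 h) hy hq hq1
  rw [sub_add_cancel] at this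
  linarith

lemma Lfun_neg (p a : ℝ) : Lfun p (-a) = -Lfun p a := by
  simp [Lfun]

lemma Lfun_of_nonneg {p a : ℝ} (hp : 2 ≤ p) (ha : 0 ≤ a) : Lfun p a = a ^ (p - 1) := by
  rw [Lfun, abs_of_nonneg ha, ← Real.rpow_add_one' ha (by linarith)]
  congr 1
  ring

lemma abs_Lfun_sub_Lfun_le {p : ℝ} (hp : 2 ≤ p) (a b : ℝ) :
    |Lfun p a - Lfun p b| ≤ (p - 1) * |a - b| * (|a| + |b|) ^ (p - 2) := by
  wlog ha : 0 ≤ a generalizing a b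
  · have h := this (-a) (-b) (by linarith)
    rwa [Lfun_neg, Lfun_neg, abs_neg, abs_neg, neg_sub_neg, neg_sub_neg, abs_sub_comm,
      abs_sub_comm b] at h
  rcases le_total 0 b with hb | hb
  · rw [Lfun_of_nonneg hp ha, Lfun_of_nonneg hp hb, abs_of_nonneg ha, abs_of_nonneg hb]
    have h := abs_rpow_sub_rpow_le_mul_add_rpow (q := p - 1) (by linarith) ha hb
    rwa [show p - 1 - 1 = p - 2 by ring] at h
  · have h0 : 0 ≤ p - 2 := by linarith
    have hS : 0 ≤ (|a| + |b|) ^ (p - 2) := by positivity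
    have h1 : |a| ^ (p - 2) ≤ (|a| + |b|) ^ (p - 2) :=
      Real.rpow_le_rpow (abs_nonneg a) (by linarith [abs_nonneg b]) h0
    have h2 : |b| ^ (p - 2) ≤ (|a| + |b|) ^ (p - 2) :=
      Real.rpow_le_rpow (abs_nonneg b) (by linarith [abs_nonneg a]) h0
    have hab : |a - b| = a - b := abs_of_nonneg (by linarith)
    calc |Lfun p a - Lfun p b| = |a| ^ (p - 2) * a + |b| ^ (p - 2) * -b := by
          rw [Lfun, Lfun, mul_neg, ← sub_eq_add_neg]
          exact abs_of_nonneg (sub_nonneg.2 ((mul_nonpos_of_nonneg_of_nonpos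
            (by positivity) hb).trans (by positivity)))
      _ ≤ (|a| + |b|) ^ (p - 2) * a + (|a| + |b|) ^ (p - 2) * -b :=
          add_le_add (mul_le_mul_of_nonneg_right h1 ha)
            (mul_le_mul_of_nonneg_right h2 (neg_nonneg.2 hb))
      _ = 1 * |a - b| * (|a| + |b|) ^ (p - 2) := by
          rw [hab]
          ring
      _ ≤ (p - 1) * |a - b| * (|a| + |b|) ^ (p - 2) := by
          gcongr
          linarith

/-- Lipschitz-type estimates for `L_p` and `M_p`, `p ≥ 2`. -/
theorem stmt_1 (p : ℝ) (hp : 2 ≤ p) (a b : ℝ) :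
    |Lfun p a - Lfun p b| ≤ 2 ^ (p - 2) * (p - 1) * |a - b| * (|a| + |b|) ^ (p - 2) ∧
    (3 ≤ p → |Mfun p a - Mfun p b| ≤ (p - 1) * |a - b| * (|a| ^ (p - 3) + |b| ^ (p - 3))) ∧
    (p < 3 → |Mfun p a - Mfun p b| ≤ |a - b| ^ (p - 2)) := by
  refine ⟨?_, fun hp3 => ?_, fun hp3 => ?_⟩
  · have h2 : (1 : ℝ) ≤ 2 ^ (p - 2) := Real.one_le_rpow one_le_two (by linarith)
    have hR : 0 ≤ (p - 1) * |a - b| * (|a| + |b|) ^ (p - 2) :=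
      mul_nonneg (mul_nonneg (by linarith) (abs_nonneg _)) (by positivity)
    calc |Lfun p a - Lfun p b| ≤ (p - 1) * |a - b| * (|a| + |b|) ^ (p - 2) :=
          abs_Lfun_sub_Lfun_le hp a b
      _ ≤ 2 ^ (p - 2) * ((p - 1) * |a - b| * (|a| + |b|) ^ (p - 2)) :=
          le_mul_of_one_le_left hR h2
      _ = _ := by ring
  · have h := abs_rpow_sub_rpow_le_mul_rpow_add_rpow (q := p - 2) (by linarith)
      (abs_nonneg a) (abs_nonneg b)
    rw [show p - 2 - 1 = p - 3 by ring] at h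
    refine h.trans ?_
    gcongr ?_ * ?_ * _
    · linarith
    · linarith
    · exact abs_abs_sub_abs_le a b
  · exact (abs_rpow_sub_rpow_le_abs_sub_rpow (by linarith) (by linarith)
      (abs_nonneg a) (abs_nonneg b)).trans
      (Real.rpow_le_rpow (abs_nonneg _) (abs_abs_sub_abs_le a b) (by linarith))
end
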